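/- Let m ≥ 1 and let M be an (m+2)×(m+2) matrix with integer entries (rows and columns indexed by 0, 1, …, m+1) satisfying: M 0 0 = 1, M 1 0 = 1, and M i 0 = 0 for all i ≥ 2; M 0 1 = 1 and M 1 1 = 0; M 0 2 = 0 and M 1 2 = 1; and M i 1 = M i 2 for all i ≥ 2. Then |det M| = 2 · |det N|, where N is the m×m integer matrix with entries N i j = M (i+2) (j+2) for 0 ≤ i, j ≤ m−1. (This is the determinant identity showing that adjoining an inner triangle whose three neighboring cross-ratios fulfill the triangle inequalities doubles the multiplicity of a tropical curve.) -/

import Mathlib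

/-- Determinant identity: adjoining an inner triangle whose
three neighboring cross-ratios fulfill the triangle inequalities doubles the
multiplicity. -/
theorem statement_17 (m : ℕ) (hm : 1 ≤ m)
    (M : Matrix (Fin (m + 2)) (Fin (m + 2)) ℤ)
    (h00 : M 0 0 = 1) (h10 : M 1 0 = 1)
    (hi0 : ∀ i : Fin (m + 2), 2 ≤ (i : ℕ) → M i 0 = 0)
    (h01 : M 0 1 = 1) (h11 : M 1 1 = 0)
    (h02 : M 0 2 = 0) (h12 : M 1 2 = 1)
    (hi12 : ∀ i : Fin (m + 2), 2 ≤ (i : ℕ) → M i 1 = M i 2) :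
    M.det.natAbs =
      2 * (Matrix.det (Matrix.of fun i j : Fin m =>
        M ⟨(i : ℕ) + 2, by have := i.isLt; omega⟩
          ⟨(j : ℕ) + 2, by have := j.isLt; omega⟩)).natAbs := by
  have hv2 : ((2 : Fin (m + 2)) : ℕ) = 2 := by
    rw [Fin.coe_ofNat_eq_mod, Nat.mod_eq_of_lt (by omega)]
  have h12ne : (1 : Fin (m + 2)) ≠ 2 := fun h => by
    have := congrArg Fin.val h
    rw [hv2] at this
    simp at this
  let A : Matrix (Fin (m + 2)) (Fin (m + 2)) ℤ :=
    M.updateCol 1 (fun k => M k 1 + (-1 : ℤ) • M k 2)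
  have hA : A.det = M.det := Matrix.det_updateCol_add_smul_self M h12ne (-1)
  have hA0 : ∀ i, A i 0 = M i 0 := fun i => Matrix.updateCol_ne (by simp)
  have hA1 : ∀ i, A i 1 = M i 1 - M i 2 := fun i => by
    simp [A, Matrix.updateCol_self, sub_eq_add_neg]
  let e : Fin 2 ⊕ Fin m ≃ Fin (m + 2) := finSumFinEquiv.trans (finCongr (Nat.add_comm 2 m))
  have he0 : e (Sum.inl 0) = 0 := by ext; simp [e]
  have he1 : e (Sum.inl 1) = 1 := by ext; simp [e]
  have her : ∀ i : Fin m, e (Sum.inr i) = ⟨(i : ℕ) + 2, by have := i.isLt; omega⟩ := fun i => by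
    ext; simp [e]
  have hblocks : A.submatrix e e = Matrix.fromBlocks !![1, 1; 1, -1]
      (Matrix.of fun i j => A (e (Sum.inl i)) (e (Sum.inr j))) 0
      (Matrix.of fun i j : Fin m =>
        M ⟨(i : ℕ) + 2, by have := i.isLt; omega⟩
          ⟨(j : ℕ) + 2, by have := j.isLt; omega⟩) := by
    ext (i | i) (j | j)
    · fin_cases i <;> fin_cases j <;> simp [he0, he1, hA0, hA1, h00, h10, h01, h11, h02, h12]
    · rfl
    · fin_cases j
      · simp [he0, her, hA0, hi0]
      · simp [he1, her, hA1, hi12]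
    · simp only [Matrix.submatrix_apply, Matrix.fromBlocks_apply₂₂, Matrix.of_apply, her]
      exact Matrix.updateCol_ne fun h => by simpa using congrArg Fin.val h
  rw [← hA, ← Matrix.det_submatrix_equiv_self e A, hblocks, Matrix.det_fromBlocks_zero₂₁,
    Int.natAbs_mul, Matrix.det_fin_two_of]
  norm_num
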